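/- Let a : ℕ → ℝ belong to one of the six blocks A, B, C, D, E, F. Then for each target block Y ∈ {A, B, C, D} there exists a connector c : ℕ → ℝ such that the Hadamard product a ⊙ c belongs to Y. In particular, each of the blocks A, B, C, D, E, F is connected to each of A, B, C, D under the Hadamard product. -/

import Mathlib

open Filter

noncomputable def L1 (a : ℕ → ℝ) : EReal := liminf (fun n => (a n : EReal)) atTop
noncomputable def L2 (a : ℕ → ℝ) : EReal := limsup (fun n => (a n : EReal)) atTop

def blockA : Set (ℕ → ℝ) := {a | L1 a = ⊥ ∧ ∃ x : ℝ, L2 a = (x : EReal)}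
def blockB : Set (ℕ → ℝ) :=
  {a | ∃ x y : ℝ, L1 a = (x : EReal) ∧ L2 a = (y : EReal) ∧ x < y}
def blockC : Set (ℕ → ℝ) := {a | (∃ x : ℝ, L1 a = (x : EReal)) ∧ L2 a = ⊤}
def blockD : Set (ℕ → ℝ) := {a | L1 a = ⊥ ∧ L2 a = ⊤}
def blockE : Set (ℕ → ℝ) := {a | L1 a = ⊥ ∧ L2 a = ⊥}
def blockF : Set (ℕ → ℝ) := {a | L1 a = ⊤ ∧ L2 a = ⊤}
def blockG : Set (ℕ → ℝ) := {a | ∃ x : ℝ, L1 a = (x : EReal) ∧ L2 a = (x : EReal)}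

def blocks : Fin 7 → Set (ℕ → ℝ) :=
  ![blockA, blockB, blockC, blockD, blockE, blockF, blockG]

theorem L1_eq_coe {g : ℕ → ℝ} {x : ℝ} (hg : ∀ n, x ≤ g n) (hx : ∃ᶠ n in atTop, g n = x) :
    L1 g = x := by
  refine le_antisymm (liminf_le_of_frequently_le' (hx.mono fun n hn => by rw [hn])) ?_
  exact le_liminf_of_le (by isBoundedDefault)
    (Eventually.of_forall fun n => EReal.coe_le_coe_iff.2 (hg n))

theorem L2_eq_coe {g : ℕ → ℝ} {x : ℝ} (hg : ∀ n, g n ≤ x) (hx : ∃ᶠ n in atTop, g n = x) :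
    L2 g = x := by
  refine le_antisymm ?_ (le_limsup_of_frequently_le' (hx.mono fun n hn => by rw [hn]))
  exact limsup_le_of_le (by isBoundedDefault)
    (Eventually.of_forall fun n => EReal.coe_le_coe_iff.2 (hg n))

theorem L1_eq_bot {g : ℕ → ℝ} (hg : ∀ M : ℝ, ∃ᶠ n in atTop, g n ≤ M) : L1 g = ⊥ := by
  rw [EReal.eq_bot_iff_forall_lt]
  intro y
  refine lt_of_le_of_lt (liminf_le_of_frequently_le' ((hg (y - 1)).mono fun n hn =>
    EReal.coe_le_coe_iff.2 hn)) ?_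
  exact EReal.coe_lt_coe_iff.2 (by linarith)

theorem L2_eq_top {g : ℕ → ℝ} (hg : ∀ M : ℝ, ∃ᶠ n in atTop, M ≤ g n) : L2 g = ⊤ := by
  rw [EReal.eq_top_iff_forall_lt]
  intro y
  refine lt_of_lt_of_le ?_ (le_limsup_of_frequently_le' ((hg (y + 1)).mono fun n hn =>
    EReal.coe_le_coe_iff.2 hn))
  exact EReal.coe_lt_coe_iff.2 (by linarith)

/-- A sequence in one of the blocks `A`–`F` is nonzero infinitely often. -/
theorem frequently_ne_zero_of_mem_blocks {a : ℕ → ℝ}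
    (ha : a ∈ blockA ∪ blockB ∪ blockC ∪ blockD ∪ blockE ∪ blockF) :
    ∃ᶠ n in atTop, a n ≠ 0 := by
  intro h
  have h0 : (fun n => (a n : EReal)) =ᶠ[atTop] fun _ => ((0 : ℝ) : EReal) :=
    h.mono fun n hn => by simpa using hn
  have h1 : L1 a = ((0 : ℝ) : EReal) := (liminf_congr h0).trans (liminf_const _)
  have h2 : L2 a = ((0 : ℝ) : EReal) := (limsup_congr h0).trans (limsup_const _)
  rcases ha with ((((ha | ha) | ha) | ha) | ha) | ha
  · exact EReal.coe_ne_bot 0 (h1.symm.trans ha.1)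
  · obtain ⟨x, y, hx, hy, hxy⟩ := ha
    have hx0 := EReal.coe_injective (h1.symm.trans hx)
    have hy0 := EReal.coe_injective (h2.symm.trans hy)
    exact hxy.ne (hx0.symm.trans hy0)
  · exact EReal.coe_ne_top 0 (h2.symm.trans ha.2)
  · exact EReal.coe_ne_bot 0 (h1.symm.trans ha.1)
  · exact EReal.coe_ne_bot 0 (h1.symm.trans ha.1)
  · exact EReal.coe_ne_top 0 (h1.symm.trans ha.1)

/-- Any sequence `f` can be realised along a subsequence of a Hadamard multiple of `a`, all other
terms being zero. -/
theorem exists_connector {a : ℕ → ℝ} (ha : ∃ᶠ n in atTop, a n ≠ 0) (f : ℕ → ℝ) :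
    ∃ (c : ℕ → ℝ) (φ : ℕ → ℕ), Tendsto φ atTop atTop ∧ (∀ k, a (φ k) * c (φ k) = f k) ∧
      ∀ n, a n * c n = 0 ∨ ∃ k, a n * c n = f k := by
  classical
  have hinf : {n | a n ≠ 0}.Infinite := Nat.frequently_atTop_iff_infinite.1 ha
  refine ⟨fun n => f (Nat.count (fun n => a n ≠ 0) n) / a n, Nat.nth fun n => a n ≠ 0,
    (Nat.nth_strictMono hinf).tendsto_atTop, fun k => ?_, fun n => ?_⟩
  · dsimp only
    rw [Nat.count_nth_of_infinite hinf, mul_div_cancel₀ _ (Nat.nth_mem_of_infinite hinf k)]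
  · by_cases hn : a n = 0
    · simp [hn]
    · exact Or.inr ⟨_, mul_div_cancel₀ _ hn⟩

/-- Some Hadamard multiple of `a` takes only values from `0`, `u` and `v`, and inherits every
property that holds frequently along `u` or along `v`. -/
theorem exists_connector_pair {a : ℕ → ℝ} (ha : ∃ᶠ n in atTop, a n ≠ 0) (u v : ℕ → ℝ) :
    ∃ c : ℕ → ℝ,
      (∀ p : ℝ → Prop, (∃ᶠ k in atTop, p (u k)) → ∃ᶠ n in atTop, p (a n * c n)) ∧
      (∀ p : ℝ → Prop, (∃ᶠ k in atTop, p (v k)) → ∃ᶠ n in atTop, p (a n * c n)) ∧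
      ∀ p : ℝ → Prop, p 0 → (∀ k, p (u k)) → (∀ k, p (v k)) → ∀ n, p (a n * c n) := by
  obtain ⟨c, φ, hφ, hc, h⟩ :=
    exists_connector ha fun k => if Even k then u (k / 2) else v (k / 2)
  have h_even : Tendsto (fun k : ℕ => 2 * k) atTop atTop :=
    tendsto_atTop_mono (fun k => by dsimp; lia) tendsto_id
  have h_odd : Tendsto (fun k : ℕ => 2 * k + 1) atTop atTop :=
    tendsto_atTop_mono (fun k => by dsimp; lia) tendsto_id
  refine ⟨c, fun p hp => ?_, fun p hp => ?_, fun p h0 hu hv n => ?_⟩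
  · refine (hφ.comp h_even).frequently (hp.mono fun k hk => ?_)
    simpa [hc] using hk
  · refine (hφ.comp h_odd).frequently (hp.mono fun k hk => ?_)
    have hk2 : (2 * k + 1) / 2 = k := by lia
    simpa [hc, hk2] using hk
  · rcases h n with hn | ⟨k, hn⟩
    · rwa [hn]
    · rw [hn]
      split_ifs
      exacts [hu _, hv _]

theorem stmt17 :
    ∀ a ∈ blockA ∪ blockB ∪ blockC ∪ blockD ∪ blockE ∪ blockF,
      ∀ Y ∈ ({blockA, blockB, blockC, blockD} : Set (Set (ℕ → ℝ))),
        ∃ c : ℕ → ℝ, (fun n => a n * c n) ∈ Y := by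
  intro a ha Y hY
  have ha := frequently_ne_zero_of_mem_blocks ha
  have h_const (x : ℝ) : ∃ᶠ _ in (atTop : Filter ℕ), x = x := Frequently.of_forall fun _ => rfl
  have h_top (M : ℝ) : ∃ᶠ k : ℕ in atTop, M ≤ (k : ℝ) :=
    (tendsto_natCast_atTop_atTop.eventually_ge_atTop M).frequently
  have h_bot (M : ℝ) : ∃ᶠ k : ℕ in atTop, -(k : ℝ) ≤ M :=
    (h_top (-M)).mono fun k hk => by linarith
  rcases hY with rfl | rfl | rfl | rfl
  · obtain ⟨c, hu, hv, h⟩ := exists_connector_pair ha (fun k => -(k : ℝ)) fun _ => 0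
    exact ⟨c, L1_eq_bot fun M => hu (· ≤ M) (h_bot M), 0,
      L2_eq_coe (h (· ≤ 0) le_rfl (fun k => by simp) fun _ => le_rfl) (hv (· = 0) (h_const 0))⟩
  · obtain ⟨c, hu, hv, h⟩ := exists_connector_pair ha (fun _ => 0) fun _ => 1
    exact ⟨c, 0, 1,
      L1_eq_coe (h (0 ≤ ·) le_rfl (fun _ => le_rfl) fun _ => zero_le_one) (hu (· = 0) (h_const 0)),
      L2_eq_coe (h (· ≤ 1) zero_le_one (fun _ => zero_le_one) fun _ => le_rfl)
        (hv (· = 1) (h_const 1)), zero_lt_one⟩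
  · obtain ⟨c, hu, hv, h⟩ := exists_connector_pair ha (fun _ => 0) fun k => (k : ℝ)
    exact ⟨c, ⟨0, L1_eq_coe (h (0 ≤ ·) le_rfl (fun _ => le_rfl) fun k => k.cast_nonneg)
      (hu (· = 0) (h_const 0))⟩, L2_eq_top fun M => hv (M ≤ ·) (h_top M)⟩
  · obtain ⟨c, hu, hv, -⟩ := exists_connector_pair ha (fun k => -(k : ℝ)) fun k => (k : ℝ)
    exact ⟨c, L1_eq_bot fun M => hu (· ≤ M) (h_bot M), L2_eq_top fun M => hv (M ≤ ·) (h_top M)⟩
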